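/- Let A = {A_t}_{t∈G} and B = {B_t}_{t∈G} be saturated C*-algebraic bundles over a finite group G with unit e. Let C = ⊕_{t∈G} A_t, D = ⊕_{t∈G} B_t, A = A_e, B = B_e; suppose C and D are unital, A and B contain the respective units, and A' ∩ C = C1. If the unital inclusions A ⊂ C and B ⊂ D induced by A and B are strongly Morita equivalent, then there exist an automorphism f of G and an A-B^f-equivalence bundle Z = {Z_t}_{t∈G} satisfying ⟨Z_t, Z_s⟩_C = A_{ts⁻¹} and ⟨Z_t, Z_s⟩_D = B_{f(t⁻¹s)} for all t, s ∈ G, where B^f = {B_{f(t)}}_{t∈G} is the C*-algebraic bundle over G induced by B and f. -/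

import Mathlib

noncomputable section

open scoped BigOperators

/-- The data and axioms of a Hilbert `C`-`D`-bimodule in the sense of
Brown–Mingo–Shen: a bimodule over the C*-algebras `C` and `D` carrying a
left `C`-valued and a right `D`-valued inner product, compatible with the
module actions and satisfying the associativity relation
`⟨x, y⟩_C • z = x • ⟨y, z⟩_D`. -/
structure HilbertBimod (C : Type*) (D : Type*) (Y : Type*)
    [NormedRing C] [StarRing C] [NormedRing D] [StarRing D]
    [NormedAddCommGroup Y] where
  lsmul : C → Y → Y
  rsmul : Y → D → Y
  linner : Y → Y → C
  rinner : Y → Y → D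
  lsmul_add : ∀ c x y, lsmul c (x + y) = lsmul c x + lsmul c y
  add_lsmul : ∀ c c' x, lsmul (c + c') x = lsmul c x + lsmul c' x
  mul_lsmul : ∀ c c' x, lsmul (c * c') x = lsmul c (lsmul c' x)
  one_lsmul : ∀ x, lsmul 1 x = x
  rsmul_add : ∀ x y d, rsmul (x + y) d = rsmul x d + rsmul y d
  add_rsmul : ∀ x d d', rsmul x (d + d') = rsmul x d + rsmul x d'
  rsmul_mul : ∀ x d d', rsmul x (d * d') = rsmul (rsmul x d) d'
  rsmul_one : ∀ x, rsmul x 1 = x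
  lsmul_rsmul : ∀ c x d, rsmul (lsmul c x) d = lsmul c (rsmul x d)
  linner_add_left : ∀ x y z, linner (x + y) z = linner x z + linner y z
  linner_add_right : ∀ x y z, linner x (y + z) = linner x y + linner x z
  linner_lsmul_left : ∀ c x y, linner (lsmul c x) y = c * linner x y
  linner_star : ∀ x y, star (linner x y) = linner y x
  rinner_add_left : ∀ x y z, rinner (x + y) z = rinner x z + rinner y z
  rinner_add_right : ∀ x y z, rinner x (y + z) = rinner x y + rinner x z
  rinner_rsmul_right : ∀ x y d, rinner x (rsmul y d) = rinner x y * d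
  rinner_star : ∀ x y, star (rinner x y) = rinner y x
  inner_assoc : ∀ x y z, lsmul (linner x y) z = rsmul x (rinner y z)
  norm_linner_self : ∀ x, ‖linner x x‖ = ‖x‖ ^ 2
  norm_rinner_self : ∀ x, ‖rinner x x‖ = ‖x‖ ^ 2

/-- Fullness of the left inner product: the closed linear span of the left
inner products is all of `C`. -/
def HilbertBimod.LFull {C D Y : Type*} [NormedRing C] [StarRing C] [NormedAlgebra ℂ C]
    [NormedRing D] [StarRing D] [NormedAddCommGroup Y]
    (E : HilbertBimod C D Y) : Prop :=
  (Submodule.span ℂ {c : C | ∃ x y : Y, c = E.linner x y}).topologicalClosure = ⊤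

/-- Fullness of the right inner product. -/
def HilbertBimod.RFull {C D Y : Type*} [NormedRing C] [StarRing C]
    [NormedRing D] [StarRing D] [NormedAlgebra ℂ D] [NormedAddCommGroup Y]
    (E : HilbertBimod C D Y) : Prop :=
  (Submodule.span ℂ {d : D | ∃ x y : Y, d = E.rinner x y}).topologicalClosure = ⊤

/-- A C*-algebraic bundle over a group `G`, presented through the grading it
induces on the C*-algebra `C = ⊕_{t ∈ G} A_t` of its sections:  a family of
closed subspaces `A_t ⊆ C` with `A_t A_s ⊆ A_{ts}`, `A_t* = A_{t⁻¹}`, whose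
internal direct sum is all of `C`. -/
structure CStarBundle (G : Type*) [Group G] [DecidableEq G] (C : Type*)
    [NormedRing C] [StarRing C] [NormedAlgebra ℂ C] where
  fiber : G → Submodule ℂ C
  fiber_closed : ∀ t, IsClosed (fiber t : Set C)
  mul_mem : ∀ {t s : G} {x y : C}, x ∈ fiber t → y ∈ fiber s → x * y ∈ fiber (t * s)
  star_mem : ∀ {t : G} {x : C}, x ∈ fiber t → star x ∈ fiber t⁻¹
  isInternal : DirectSum.IsInternal fiber

/-- A C*-algebraic bundle is saturated if the closed span of `A_t A_t*` is
`A_e` for every `t`. -/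
def CStarBundle.Saturated {G : Type*} [Group G] [DecidableEq G] {C : Type*}
    [NormedRing C] [StarRing C] [NormedAlgebra ℂ C] (𝒜 : CStarBundle G C) : Prop :=
  ∀ t, (Submodule.span ℂ
      {x : C | ∃ a ∈ 𝒜.fiber t, ∃ b ∈ 𝒜.fiber t, x = a * star b}).topologicalClosure
    = 𝒜.fiber 1

/-- The data of an equivalence bundle in the sense of Abadie–Ferraro between
two C*-algebraic bundles with fibers `Afib` (inside `C`) and `Bfib` (inside
`D`):  a grading `{X_t}_{t ∈ G}` of the `C`-`D`-bimodule `Y = ⊕_{t∈G} X_t`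
which is compatible with the two bundle gradings (conditions (1R)-(7R) and
(1L)-(7L) of Abadie–Ferraro). -/
structure EquivBundleData {G : Type*} [Group G] [DecidableEq G] {C D Y : Type*}
    [NormedRing C] [StarRing C] [NormedAlgebra ℂ C]
    [NormedRing D] [StarRing D] [NormedAlgebra ℂ D]
    [NormedAddCommGroup Y]
    (Afib : G → Submodule ℂ C) (Bfib : G → Submodule ℂ D)
    (E : HilbertBimod C D Y) where
  fiber : G → AddSubgroup Y
  fiber_closed : ∀ t, IsClosed (fiber t : Set Y)
  isInternal : DirectSum.IsInternal fiber
  lsmul_mem : ∀ {t s : G} {c : C} {x : Y}, c ∈ Afib t → x ∈ fiber s →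
    E.lsmul c x ∈ fiber (t * s)
  rsmul_mem : ∀ {t s : G} {x : Y} {d : D}, x ∈ fiber t → d ∈ Bfib s →
    E.rsmul x d ∈ fiber (t * s)
  linner_mem : ∀ {t s : G} {x y : Y}, x ∈ fiber t → y ∈ fiber s →
    E.linner x y ∈ Afib (t * s⁻¹)
  rinner_mem : ∀ {t s : G} {x y : Y}, x ∈ fiber t → y ∈ fiber s →
    E.rinner x y ∈ Bfib (t⁻¹ * s)

/-- The strengthened fullness conditions `⟨X_t , X_s⟩_C = A_{ts⁻¹}` and
`⟨X_t , X_s⟩_D = B_{t⁻¹s}` for an equivalence bundle. -/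
def EquivBundleData.StrictSpan {G : Type*} [Group G] [DecidableEq G] {C D Y : Type*}
    [NormedRing C] [StarRing C] [NormedAlgebra ℂ C]
    [NormedRing D] [StarRing D] [NormedAlgebra ℂ D]
    [NormedAddCommGroup Y]
    {Afib : G → Submodule ℂ C} {Bfib : G → Submodule ℂ D}
    {E : HilbertBimod C D Y} (Z : EquivBundleData Afib Bfib E) : Prop :=
  (∀ t s : G, Submodule.span ℂ
      {c : C | ∃ x ∈ Z.fiber t, ∃ y ∈ Z.fiber s, c = E.linner x y} = Afib (t * s⁻¹)) ∧
  (∀ t s : G, Submodule.span ℂ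
      {d : D | ∃ x ∈ Z.fiber t, ∃ y ∈ Z.fiber s, d = E.rinner x y} = Bfib (t⁻¹ * s))

/-- A witness of strong Morita equivalence of the unital inclusions
`A ⊆ C` and `B ⊆ D`:  a `C`-`D`-equivalence bimodule `Y` together with a
closed subspace `X₀ ⊆ Y` which is an `A`-`B`-equivalence bimodule and such
that `⟨Y , X₀⟩_C` is dense in `C` and `⟨Y , X₀⟩_D` is dense in `D`. -/
structure MoritaIncl (C D : Type*)
    [NormedRing C] [StarRing C] [NormedAlgebra ℂ C]
    [NormedRing D] [StarRing D] [NormedAlgebra ℂ D]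
    (A : Submodule ℂ C) (B : Submodule ℂ D) where
  Y : Type
  [instN : NormedAddCommGroup Y]
  [instC : CompleteSpace Y]
  E : HilbertBimod C D Y
  lFull : E.LFull
  rFull : E.RFull
  X₀ : AddSubgroup Y
  closed_X₀ : IsClosed (X₀ : Set Y)
  lsmul_mem : ∀ {a : C} {x : Y}, a ∈ A → x ∈ X₀ → E.lsmul a x ∈ X₀
  rsmul_mem : ∀ {x : Y} {b : D}, x ∈ X₀ → b ∈ B → E.rsmul x b ∈ X₀
  linner_mem : ∀ {x y : Y}, x ∈ X₀ → y ∈ X₀ → E.linner x y ∈ A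
  rinner_mem : ∀ {x y : Y}, x ∈ X₀ → y ∈ X₀ → E.rinner x y ∈ B
  linner_full : (Submodule.span ℂ
      {c : C | ∃ x ∈ X₀, ∃ y ∈ X₀, c = E.linner x y}).topologicalClosure = A
  rinner_full : (Submodule.span ℂ
      {d : D | ∃ x ∈ X₀, ∃ y ∈ X₀, d = E.rinner x y}).topologicalClosure = B
  linner_span : (Submodule.span ℂ
      {c : C | ∃ y : Y, ∃ x ∈ X₀, c = E.linner y x}).topologicalClosure = ⊤
  rinner_span : (Submodule.span ℂ
      {d : D | ∃ y : Y, ∃ x ∈ X₀, d = E.rinner y x}).topologicalClosure = ⊤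

/-- Strong Morita equivalence of the unital inclusions `A ⊆ C` and `B ⊆ D`. -/
def StronglyMoritaEquivalentIncl (C D : Type*)
    [NormedRing C] [StarRing C] [NormedAlgebra ℂ C]
    [NormedRing D] [StarRing D] [NormedAlgebra ℂ D]
    (A : Submodule ℂ C) (B : Submodule ℂ D) : Prop :=
  Nonempty (MoritaIncl C D A B)

/-- An equivalence bundle between the bundle with fibers `Afib` in `C` and
the bundle with fibers `Bfib` in `D`, with unspecified carrier bimodule. -/
structure EquivBundleCarrier {G : Type*} [Group G] [DecidableEq G] {C D : Type*}
    [NormedRing C] [StarRing C] [NormedAlgebra ℂ C]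
    [NormedRing D] [StarRing D] [NormedAlgebra ℂ D]
    (Afib : G → Submodule ℂ C) (Bfib : G → Submodule ℂ D) where
  Y : Type
  [instN : NormedAddCommGroup Y]
  [instC : CompleteSpace Y]
  E : HilbertBimod C D Y
  lFull : E.LFull
  rFull : E.RFull
  bundle : EquivBundleData Afib Bfib E

attribute [instance] EquivBundleCarrier.instN EquivBundleCarrier.instC

/-- A family of additive submonoids over a finite index type is an internal direct sum iff every
element is a sum of components and the components of zero vanish. -/
theorem isInternal_iff_sum {ι M S : Type*} [DecidableEq ι] [Fintype ι] [AddCommGroup M]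
    [SetLike S M] [AddSubgroupClass S M] (F : ι → S) :
    DirectSum.IsInternal F ↔
      (∀ y : M, ∃ a : ι → M, (∀ t, a t ∈ F t) ∧ ∑ t, a t = y) ∧
      (∀ a : ι → M, (∀ t, a t ∈ F t) → ∑ t, a t = 0 → ∀ t, a t = 0) := by
  have key : ∀ x : DirectSum ι (fun i => F i),
      DirectSum.coeAddMonoidHom F x = ∑ t, (x t : M) := by
    classical
    intro x
    rw [DirectSum.coeAddMonoidHom_eq_dfinsuppSum]
    exact DFinsupp.sum_eq_sum_fintype _ (fun _ => rfl)
  constructor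
  · rintro ⟨hinj, hsurj⟩
    refine ⟨fun y => ?_, fun a ha h0 t => ?_⟩
    · obtain ⟨x, rfl⟩ := hsurj y
      exact ⟨fun t => x t, fun t => (x t).2, (key x).symm⟩
    · let x : DirectSum ι (fun i => F i) := DFinsupp.equivFunOnFintype.symm fun t => ⟨a t, ha t⟩
      have hx : ∀ t, ((x t : F t) : M) = a t := fun t => rfl
      have : x = 0 := by
        apply hinj
        rw [key, map_zero, ← h0]
        rfl
      rw [← hx, this]
      rfl
  · rintro ⟨hex, huniq⟩
    refine ⟨(injective_iff_map_eq_zero _).2 fun x hx => ?_, fun y => ?_⟩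
    · rw [key] at hx
      exact DFinsupp.ext fun t => Subtype.ext (huniq _ (fun t => (x t).2) hx t)
    · obtain ⟨a, ha, rfl⟩ := hex y
      refine ⟨DFinsupp.equivFunOnFintype.symm fun t => ⟨a t, ha t⟩, ?_⟩
      rw [key]
      rfl

section InternalSum

variable {ι M S : Type*} [DecidableEq ι] [Fintype ι] [AddCommGroup M]
  [SetLike S M] [AddSubgroupClass S M] {F : ι → S}

theorem DirectSum.IsInternal.eq_of_sum_eq (hF : DirectSum.IsInternal F) {a b : ι → M}
    (ha : ∀ t, a t ∈ F t) (hb : ∀ t, b t ∈ F t) (h : ∑ t, a t = ∑ t, b t) (t : ι) :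
    a t = b t := by
  refine sub_eq_zero.1 (((isInternal_iff_sum F).1 hF).2 (fun t => a t - b t)
    (fun t => sub_mem (ha t) (hb t)) ?_ t)
  simp [h]

theorem DirectSum.IsInternal.index_eq_of_mem (hF : DirectSum.IsInternal F) {y : M} {s t : ι}
    (hs : y ∈ F s) (ht : y ∈ F t) (hy : y ≠ 0) : s = t := by
  by_contra hst
  apply hy
  have hmem : ∀ {u : ι}, y ∈ F u → ∀ v, (Pi.single u y : ι → M) v ∈ F v := by
    intro u hu v
    rcases eq_or_ne v u with rfl | h
    · simpa using hu
    · simp [h]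
  have := hF.eq_of_sum_eq (hmem hs) (hmem ht) (by simp) s
  simpa [hst] using this

/-- The coordinate projections of an internal direct sum over a finite index type, together with
the fact that they commute with every additive map preserving all components. -/
theorem DirectSum.IsInternal.exists_projections (hF : DirectSum.IsInternal F) :
    ∃ P : ι → M →+ M, (∀ t y, P t y ∈ F t) ∧ (∀ y, ∑ t, P t y = y) ∧
      ∀ T : M →+ M, (∀ t, ∀ y ∈ F t, T y ∈ F t) → ∀ t y, P t (T y) = T (P t y) := by
  choose P hP hsum using ((isInternal_iff_sum F).1 hF).1
  refine ⟨fun t => AddMonoidHom.mk' (fun y => P y t) fun x y => ?_, fun t y => hP y t, hsum,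
    fun T hT t y => ?_⟩
  · refine hF.eq_of_sum_eq (b := fun t => P x t + P y t) (hP _)
      (fun t => add_mem (hP x t) (hP y t)) ?_ t
    simp [Finset.sum_add_distrib, hsum]
  · refine hF.eq_of_sum_eq (b := fun t => T (P y t)) (hP _) (fun t => hT t _ (hP y t)) ?_ t
    rw [← map_sum, hsum, hsum]

end InternalSum

/-- A dense left ideal of a closed unital subalgebra contains the unit. -/
theorem one_mem_of_topologicalClosure_eq {C : Type*} [CStarAlgebra C] {A I : Submodule ℂ C}
    (hA : IsClosed (A : Set C)) (h1 : (1 : C) ∈ A)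
    (hmul : ∀ {x y : C}, x ∈ A → y ∈ A → x * y ∈ A) (hI : I.topologicalClosure = A)
    (hideal : ∀ {x y : C}, x ∈ A → y ∈ I → x * y ∈ I) : (1 : C) ∈ I := by
  have h1' : (1 : C) ∈ closure (I : Set C) := by
    rw [← Submodule.topologicalClosure_coe, hI]
    exact h1
  obtain ⟨u, hu, hdist⟩ := Metric.mem_closure_iff.1 h1' 1 one_pos
  have huA : u ∈ A := hI ▸ I.le_topologicalClosure hu
  rw [dist_eq_norm] at hdist
  have hpow : ∀ n : ℕ, (1 - u) ^ n ∈ A := by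
    intro n
    induction n with
    | zero => simpa using h1
    | succ n ih =>
      rw [pow_succ]
      exact hmul ih (sub_mem h1 huA)
  have hsum := summable_geometric_of_norm_lt_one hdist
  have hv : ∑' n : ℕ, (1 - u) ^ n ∈ A :=
    hA.mem_of_tendsto hsum.hasSum (Filter.Eventually.of_forall fun s =>
      A.sum_mem fun n _ => hpow n)
  have := hideal hv hu
  have hinv := geom_series_mul_neg (1 - u) hdist
  rw [sub_sub_cancel] at hinv
  rwa [hinv] at this

namespace HilbertBimod

variable {C D Y : Type*} [CStarAlgebra C] [CStarAlgebra D] [NormedAddCommGroup Y]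

/-- The conjugate bimodule, on the same underlying additive group. -/
def flip (E : HilbertBimod C D Y) : HilbertBimod D C Y where
  lsmul d y := E.rsmul y (star d)
  rsmul y c := E.lsmul (star c) y
  linner := E.rinner
  rinner := E.linner
  lsmul_add _ _ _ := E.rsmul_add _ _ _
  add_lsmul _ _ _ := by rw [star_add, E.add_rsmul]
  mul_lsmul _ _ _ := by rw [star_mul, E.rsmul_mul]
  one_lsmul _ := by rw [star_one, E.rsmul_one]
  rsmul_add _ _ _ := E.lsmul_add _ _ _
  add_rsmul _ _ _ := by rw [star_add, E.add_lsmul]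
  rsmul_mul _ _ _ := by rw [star_mul, E.mul_lsmul]
  rsmul_one _ := by rw [star_one, E.one_lsmul]
  lsmul_rsmul _ _ _ := (E.lsmul_rsmul _ _ _).symm
  linner_add_left := E.rinner_add_left
  linner_add_right := E.rinner_add_right
  linner_lsmul_left d x y := by
    rw [← E.rinner_star, E.rinner_rsmul_right, star_mul, star_star, E.rinner_star]
  linner_star := E.rinner_star
  rinner_add_left := E.linner_add_left
  rinner_add_right := E.linner_add_right
  rinner_rsmul_right x y c := by
    rw [← E.linner_star, E.linner_lsmul_left, star_mul, star_star, E.linner_star]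
  rinner_star := E.linner_star
  inner_assoc x y z := by rw [E.rinner_star, E.linner_star, E.inner_assoc]
  norm_linner_self := E.norm_rinner_self
  norm_rinner_self := E.norm_linner_self

variable (E : HilbertBimod C D Y)

theorem flip_linner (x y : Y) : E.flip.linner x y = E.rinner x y := rfl

theorem flip_lsmul (d : D) (y : Y) : E.flip.lsmul d y = E.rsmul y (star d) := rfl

theorem rsmul_eq_flip (d : D) (y : Y) : E.rsmul y d = E.flip.lsmul (star d) y := by
  rw [flip_lsmul, star_star]

/-- The left action as a biadditive map. -/
def lsmulHom : C →+ Y →+ Y :=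
  AddMonoidHom.mk' (fun c => AddMonoidHom.mk' (E.lsmul c) (E.lsmul_add c))
    fun c c' => AddMonoidHom.ext fun x => E.add_lsmul c c' x

/-- The left inner product as a biadditive map. -/
def linnerHom : Y →+ Y →+ C :=
  AddMonoidHom.mk' (fun x => AddMonoidHom.mk' (E.linner x) (E.linner_add_right x))
    fun x x' => AddMonoidHom.ext fun y => E.linner_add_left x x' y

theorem lsmul_zero (c : C) : E.lsmul c 0 = 0 := map_zero (E.lsmulHom c)

theorem zero_lsmul (y : Y) : E.lsmul 0 y = 0 := DFunLike.congr_fun (map_zero E.lsmulHom) y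

theorem linner_zero (x : Y) : E.linner x 0 = 0 := map_zero (E.linnerHom x)

theorem zero_linner (y : Y) : E.linner 0 y = 0 := DFunLike.congr_fun (map_zero E.linnerHom) y

theorem neg_linner (x y : Y) : E.linner (-x) y = -E.linner x y :=
  DFunLike.congr_fun (map_neg E.linnerHom x) y

theorem sub_linner (x x' y : Y) : E.linner (x - x') y = E.linner x y - E.linner x' y :=
  DFunLike.congr_fun (map_sub E.linnerHom x x') y

theorem lsmul_sum {ι : Type*} (s : Finset ι) (c : C) (y : ι → Y) :
    E.lsmul c (∑ i ∈ s, y i) = ∑ i ∈ s, E.lsmul c (y i) := map_sum (E.lsmulHom c) y s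

theorem sum_lsmul {ι : Type*} (s : Finset ι) (c : ι → C) (y : Y) :
    E.lsmul (∑ i ∈ s, c i) y = ∑ i ∈ s, E.lsmul (c i) y := by
  refine (DFunLike.congr_fun (map_sum E.lsmulHom c s) y).trans ?_
  rw [AddMonoidHom.finsetSum_apply]
  rfl

theorem rsmul_sum {ι : Type*} (s : Finset ι) (d : ι → D) (y : Y) :
    E.rsmul y (∑ i ∈ s, d i) = ∑ i ∈ s, E.rsmul y (d i) := by
  simp only [rsmul_eq_flip, star_sum, sum_lsmul]

theorem linner_sum {ι : Type*} (s : Finset ι) (x : Y) (y : ι → Y) :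
    E.linner x (∑ i ∈ s, y i) = ∑ i ∈ s, E.linner x (y i) := map_sum (E.linnerHom x) y s

theorem sum_linner {ι : Type*} (s : Finset ι) (x : ι → Y) (y : Y) :
    E.linner (∑ i ∈ s, x i) y = ∑ i ∈ s, E.linner (x i) y := by
  refine (DFunLike.congr_fun (map_sum E.linnerHom x s) y).trans ?_
  rw [AddMonoidHom.finsetSum_apply]
  rfl

theorem linner_lsmul_right (c : C) (x y : Y) :
    E.linner x (E.lsmul c y) = E.linner x y * star c := by
  rw [← E.linner_star, E.linner_lsmul_left, star_mul, E.linner_star]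

theorem norm_lsmul_le (c : C) (y : Y) : ‖E.lsmul c y‖ ≤ ‖c‖ * ‖y‖ := by
  refine le_of_sq_le_sq ?_ (by positivity)
  rw [← E.norm_linner_self, E.linner_lsmul_left, E.linner_lsmul_right, mul_pow,
    ← E.norm_linner_self y]
  calc ‖c * (E.linner y y * star c)‖ ≤ ‖c‖ * (‖E.linner y y‖ * ‖star c‖) :=
        (norm_mul_le _ _).trans (by gcongr; exact norm_mul_le _ _)
    _ = _ := by rw [norm_star]; ring

theorem norm_smul_one_lsmul_le (z : ℂ) (y : Y) : ‖E.lsmul (z • (1 : C)) y‖ ≤ ‖z‖ * ‖y‖ := by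
  rcases subsingleton_or_nontrivial C with h | h
  · rw [Subsingleton.elim (z • (1 : C)) 0, zero_lsmul, norm_zero]
    positivity
  · simpa [norm_smul] using E.norm_lsmul_le (z • (1 : C)) y

theorem smul_one_linner (z : ℂ) (x y : Y) :
    E.linner (E.lsmul (z • (1 : C)) x) y = z • E.linner x y := by
  rw [E.linner_lsmul_left, smul_mul_assoc, one_mul]

theorem linner_smul_one (z : ℂ) (x y : Y) :
    E.linner x (E.lsmul (z • (1 : C)) y) = star z • E.linner x y := by
  rw [linner_lsmul_right, star_smul, star_one, mul_smul_comm, mul_one]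

theorem four_smul_linner (x y : Y) :
    (4 : ℂ) • E.linner x y = ∑ k : Fin 4, (Complex.I ^ (k : ℕ)) •
      E.linner (x + E.lsmul (Complex.I ^ (k : ℕ) • (1 : C)) y)
        (x + E.lsmul (Complex.I ^ (k : ℕ) • (1 : C)) y) := by
  simp only [E.linner_add_left, E.linner_add_right, smul_one_linner, linner_smul_one,
    Fin.sum_univ_four, smul_add, smul_smul]
  have h2 : Complex.I ^ 2 = -1 := Complex.I_sq
  have h3 : Complex.I ^ 3 = -Complex.I := by rw [pow_succ, h2]; ring
  simp [h2, h3]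
  module

theorem norm_linner_le_add_sq (x y : Y) : ‖E.linner x y‖ ≤ (‖x‖ + ‖y‖) ^ 2 := by
  have h : ‖(4 : ℂ) • E.linner x y‖ ≤ ∑ _k : Fin 4, (‖x‖ + ‖y‖) ^ 2 := by
    rw [four_smul_linner]
    refine norm_sum_le_of_le _ fun k _ => ?_
    rw [norm_smul, norm_pow, Complex.norm_I, one_pow, one_mul, E.norm_linner_self]
    gcongr
    refine (norm_add_le _ _).trans ?_
    gcongr
    simpa using E.norm_smul_one_lsmul_le (Complex.I ^ (k : ℕ)) y
  simp [norm_smul] at h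
  linarith

theorem norm_linner_le (x y : Y) : ‖E.linner x y‖ ≤ 4 * ‖x‖ * ‖y‖ := by
  rcases eq_or_ne x 0 with rfl | hx
  · simp [zero_linner]
  rcases eq_or_ne y 0 with rfl | hy
  · simp [linner_zero]
  have hx' : 0 < ‖x‖ := norm_pos_iff.2 hx
  have hy' : 0 < ‖y‖ := norm_pos_iff.2 hy
  have hunit : ∀ {w : Y}, 0 < ‖w‖ → ‖E.lsmul (((‖w‖⁻¹ : ℝ) : ℂ) • (1 : C)) w‖ ≤ 1 := by
    intro w hw
    refine (E.norm_smul_one_lsmul_le _ w).trans ?_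
    simp [hw.ne']
  have h := (E.norm_linner_le_add_sq (E.lsmul (((‖x‖⁻¹ : ℝ) : ℂ) • (1 : C)) x)
    (E.lsmul (((‖y‖⁻¹ : ℝ) : ℂ) • (1 : C)) y)).trans
    (pow_le_pow_left₀ (by positivity) (add_le_add (hunit hx') (hunit hy')) 2)
  rw [smul_one_linner, linner_smul_one, norm_smul, norm_smul, norm_star] at h
  simp only [Complex.norm_real, norm_inv, norm_norm] at h
  rw [← mul_assoc, ← mul_inv, inv_mul_le_iff₀ (by positivity)] at h
  linarith

theorem continuous_linner_left (y : Y) : Continuous fun x => E.linner x y := by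
  refine continuous_iff_continuousAt.2 fun x₀ => ?_
  refine tendsto_iff_norm_sub_tendsto_zero.2 (squeeze_zero (fun _ => norm_nonneg _)
    (fun x => ?_ : ∀ x, _ ≤ 4 * ‖x - x₀‖ * ‖y‖) ?_)
  · rw [← sub_linner]
    exact E.norm_linner_le _ _
  · have : Continuous fun x : Y => 4 * ‖x - x₀‖ * ‖y‖ := by fun_prop
    simpa using this.tendsto x₀

/-- The left inner products of elements of `W` span the unit. -/
def LUnital (W : AddSubgroup Y) : Prop :=
  ∃ (n : ℕ) (x y : Fin n → Y), (∀ i, x i ∈ W) ∧ (∀ i, y i ∈ W) ∧ ∑ i, E.linner (x i) (y i) = 1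

theorem lUnital_of_fintype {ι : Type*} [Fintype ι] {W : AddSubgroup Y} {x y : ι → Y}
    (hx : ∀ i, x i ∈ W) (hy : ∀ i, y i ∈ W) (h : ∑ i, E.linner (x i) (y i) = 1) :
    E.LUnital W :=
  ⟨_, x ∘ (Fintype.equivFin ι).symm, y ∘ (Fintype.equivFin ι).symm, fun _ => hx _, fun _ => hy _,
    by rw [← h]; exact Equiv.sum_comp (Fintype.equivFin ι).symm fun i => E.linner (x i) (y i)⟩

variable {E}

theorem LUnital.of_one_mem_span {W : AddSubgroup Y}
    (hW : ∀ (z : ℂ), ∀ x ∈ W, E.lsmul (z • (1 : C)) x ∈ W)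
    (h : (1 : C) ∈ Submodule.span ℂ {c : C | ∃ x ∈ W, ∃ y ∈ W, c = E.linner x y}) :
    E.LUnital W := by
  suffices H : ∀ c ∈ Submodule.span ℂ {c : C | ∃ x ∈ W, ∃ y ∈ W, c = E.linner x y},
      ∃ (n : ℕ) (x y : Fin n → Y), (∀ i, x i ∈ W) ∧ (∀ i, y i ∈ W) ∧
        ∑ i, E.linner (x i) (y i) = c from H 1 h
  intro c hc
  induction hc using Submodule.span_induction with
  | mem c hc =>
    obtain ⟨x, hx, y, hy, rfl⟩ := hc
    exact ⟨1, fun _ => x, fun _ => y, fun _ => hx, fun _ => hy, by simp⟩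
  | zero => exact ⟨0, Fin.elim0, Fin.elim0, fun i => i.elim0, fun i => i.elim0, by simp⟩
  | add c c' _ _ hc hc' =>
    obtain ⟨n, x, y, hx, hy, rfl⟩ := hc
    obtain ⟨m, x', y', hx', hy', rfl⟩ := hc'
    refine ⟨n + m, Fin.append x x', Fin.append y y', fun i => ?_, fun i => ?_, ?_⟩
    · refine Fin.addCases (fun i => ?_) (fun i => ?_) i <;> simp [hx, hx']
    · refine Fin.addCases (fun i => ?_) (fun i => ?_) i <;> simp [hy, hy']
    · simp [Fin.sum_univ_add]
  | smul z c _ hc =>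
    obtain ⟨n, x, y, hx, hy, rfl⟩ := hc
    refine ⟨n, fun i => E.lsmul (z • (1 : C)) (x i), y, fun i => hW z _ (hx i), hy, ?_⟩
    simp [smul_one_linner, Finset.smul_sum]

theorem LUnital.eq_zero {W : AddSubgroup Y} (hW : E.LUnital W) {c : C}
    (hc : ∀ y ∈ W, E.lsmul c y = 0) : c = 0 := by
  obtain ⟨n, x, y, hx, -, h⟩ := hW
  rw [← mul_one c, ← h, Finset.mul_sum]
  refine Finset.sum_eq_zero fun i _ => ?_
  rw [← E.linner_lsmul_left, hc _ (hx i), zero_linner]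

theorem LUnital.exists_ne_zero [Nontrivial C] {W : AddSubgroup Y} (hW : E.LUnital W) :
    ∃ y ∈ W, y ≠ 0 := by
  by_contra! h
  exact one_ne_zero (hW.eq_zero (c := (1 : C)) fun y hy => by rw [h y hy, lsmul_zero])

theorem LUnital.linner_rsmul_left {W : AddSubgroup Y} (hW : E.LUnital W) (x y : Y) (d : D) :
    E.linner (E.rsmul x d) y = E.linner x (E.rsmul y (star d)) := by
  refine sub_eq_zero.1 (hW.eq_zero fun z _ => ?_)
  have hz := DFunLike.congr_fun (map_sub E.lsmulHom (E.linner (E.rsmul x d) y)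
    (E.linner x (E.rsmul y (star d)))) z
  refine hz.trans (sub_eq_zero.2 ?_)
  change E.lsmul _ z = E.lsmul _ z
  rw [E.inner_assoc, E.inner_assoc, ← E.rsmul_mul, ← E.rinner_star z (E.rsmul y (star d)),
    E.rinner_rsmul_right, star_mul, star_star, E.rinner_star]

variable (E) in
/-- The conditions on `X` in a strong Morita equivalence of unital inclusions, with fullness in
algebraic form. -/
structure IsUnitalSubBimod (A : Submodule ℂ C) (B : Submodule ℂ D) (X : AddSubgroup Y) :
    Prop where
  lsmul_mem : ∀ {a : C} {x : Y}, a ∈ A → x ∈ X → E.lsmul a x ∈ X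
  rsmul_mem : ∀ {x : Y} {b : D}, x ∈ X → b ∈ B → E.rsmul x b ∈ X
  rinner_mem : ∀ {x y : Y}, x ∈ X → y ∈ X → E.rinner x y ∈ B
  lUnital : E.LUnital X

/-- An additive `A`-`B`-bimodule endomorphism is a scalar on each unital sub-bimodule, provided
that the relative commutant of `A` is trivial. -/
theorem IsUnitalSubBimod.exists_scalar {A : Submodule ℂ C} {B : Submodule ℂ D}
    {W : AddSubgroup Y} (hW : E.IsUnitalSubBimod A B W)
    (hcomm : ∀ x : C, (∀ a ∈ A, a * x = x * a) → ∃ z : ℂ, x = z • (1 : C))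
    (φ : Y →+ Y) (hl : ∀ a ∈ A, ∀ y, φ (E.lsmul a y) = E.lsmul a (φ y))
    (hr : ∀ b ∈ B, ∀ y, φ (E.rsmul y b) = E.rsmul (φ y) b) :
    ∃ z : ℂ, ∀ y ∈ W, φ y = E.lsmul (z • (1 : C)) y := by
  obtain ⟨n, u, v, hu, hv, huv⟩ := hW.lUnital
  set w : C := ∑ i, E.linner (φ (u i)) (v i) with hw
  have hφ : ∀ y ∈ W, φ y = E.lsmul w y := by
    intro y hy
    conv_lhs => rw [← E.one_lsmul y, ← huv, sum_lsmul, map_sum]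
    rw [hw, sum_lsmul]
    refine Finset.sum_congr rfl fun i _ => ?_
    rw [E.inner_assoc, E.inner_assoc, hr _ (hW.rinner_mem (hv i) hy)]
  obtain ⟨z, hz⟩ := hcomm w fun a ha => by
    refine sub_eq_zero.1 (hW.lUnital.eq_zero fun y hy => ?_)
    have hs := DFunLike.congr_fun (map_sub E.lsmulHom (a * w) (w * a)) y
    refine hs.trans (sub_eq_zero.2 ?_)
    change E.lsmul _ y = E.lsmul _ y
    rw [E.mul_lsmul, E.mul_lsmul, ← hφ y hy, ← hφ _ (hW.lsmul_mem ha hy), hl a ha]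
  exact ⟨z, fun y hy => by rw [hφ y hy, hz]⟩

/-- A unital sub-bimodule is contained in one component of any bimodule grading. -/
theorem IsUnitalSubBimod.exists_le [Nontrivial C] {A : Submodule ℂ C} {B : Submodule ℂ D}
    {W : AddSubgroup Y} (hW : E.IsUnitalSubBimod A B W) (h1 : (1 : C) ∈ A)
    (hcomm : ∀ x : C, (∀ a ∈ A, a * x = x * a) → ∃ z : ℂ, x = z • (1 : C))
    {ι : Type*} [Fintype ι] [DecidableEq ι] {F : ι → AddSubgroup Y}
    (hF : DirectSum.IsInternal F)
    (hl : ∀ t, ∀ a ∈ A, ∀ y ∈ F t, E.lsmul a y ∈ F t)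
    (hr : ∀ t, ∀ b ∈ B, ∀ y ∈ F t, E.rsmul y b ∈ F t) :
    ∃ t, W ≤ F t := by
  obtain ⟨P, hP, hsum, hPT⟩ := hF.exists_projections
  have hscal : ∀ t, ∃ z : ℂ, ∀ y ∈ W, P t y = E.lsmul (z • (1 : C)) y := fun t =>
    hW.exists_scalar hcomm (P t)
      (fun a ha => hPT (E.lsmulHom a) (fun t => hl t a ha) t)
      (fun b hb => hPT (AddMonoidHom.mk' (fun y => E.rsmul y b) fun x y => E.rsmul_add x y b)
        (fun t => hr t b hb) t)
  choose z hz using hscal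
  obtain ⟨y, hy, hy0⟩ := hW.lUnital.exists_ne_zero
  obtain ⟨t, ht⟩ : ∃ t, z t ≠ 0 := by
    by_contra! h
    apply hy0
    rw [← hsum y]
    exact Finset.sum_eq_zero fun t _ => by rw [hz t y hy, h, zero_smul, zero_lsmul]
  refine ⟨t, fun x hx => ?_⟩
  have hx' := hl t ((z t)⁻¹ • (1 : C)) (A.smul_mem _ h1) _ (hP t x)
  rwa [hz t x hx, ← E.mul_lsmul, smul_mul_smul_comm, inv_mul_cancel₀ ht, one_smul, one_mul,
    E.one_lsmul] at hx'

variable (E) in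
/-- The elements of `Y` whose left inner products against `X` lie in `F`. -/
def leftFiber (X : AddSubgroup Y) (F : Submodule ℂ C) : AddSubgroup Y where
  carrier := {y | ∀ x ∈ X, E.linner y x ∈ F}
  add_mem' ha hb x hx := by
    rw [E.linner_add_left]
    exact F.add_mem (ha x hx) (hb x hx)
  zero_mem' x _ := by
    rw [zero_linner]
    exact F.zero_mem
  neg_mem' ha x hx := by
    rw [neg_linner]
    exact F.neg_mem (ha x hx)

theorem isClosed_leftFiber (X : AddSubgroup Y) {F : Submodule ℂ C} (hF : IsClosed (F : Set C)) :
    IsClosed (E.leftFiber X F : Set Y) := by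
  have : (E.leftFiber X F : Set Y) = ⋂ x ∈ X, (fun y => E.linner y x) ⁻¹' (F : Set C) := by
    ext y
    simp [leftFiber]
  rw [this]
  exact isClosed_biInter fun x _ => hF.preimage (E.continuous_linner_left x)

variable (E) in
/-- The conditions on `X` which are symmetric under passing to the conjugate bimodule. -/
structure IsEquivSubBimod (A : Submodule ℂ C) (B : Submodule ℂ D) (X : AddSubgroup Y) :
    Prop extends E.IsUnitalSubBimod A B X where
  linner_mem : ∀ {x y : Y}, x ∈ X → y ∈ X → E.linner x y ∈ A
  rUnital : E.flip.LUnital X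

end HilbertBimod

section Bundle

variable {G : Type*} [Group G] [DecidableEq G]

theorem CStarBundle.star_mem' {C : Type*} [CStarAlgebra C] (𝒜 : CStarBundle G C) {x : C}
    (hx : x ∈ 𝒜.fiber 1) : star x ∈ 𝒜.fiber 1 := by
  simpa using 𝒜.star_mem hx

theorem CStarBundle.mul_mem' {C : Type*} [CStarAlgebra C] (𝒜 : CStarBundle G C) {s t u : G}
    {x y : C} (hx : x ∈ 𝒜.fiber s) (hy : y ∈ 𝒜.fiber t) (h : s * t = u) : x * y ∈ 𝒜.fiber u :=
  h ▸ 𝒜.mul_mem hx hy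

/-- In a saturated bundle with unit in the unit fiber, the unit is a finite sum of products
`a * star b` with `a, b` in any given fiber. -/
theorem CStarBundle.Saturated.exists_sum_eq_one {C : Type*} [CStarAlgebra C]
    {𝒜 : CStarBundle G C} (h : 𝒜.Saturated) (h1 : (1 : C) ∈ 𝒜.fiber 1) (t : G) :
    ∃ (n : ℕ) (a b : Fin n → C), (∀ i, a i ∈ 𝒜.fiber t) ∧ (∀ i, b i ∈ 𝒜.fiber t) ∧
      ∑ i, a i * star (b i) = 1 := by
  have hone : (1 : C) ∈ Submodule.span ℂ
      {x : C | ∃ a ∈ 𝒜.fiber t, ∃ b ∈ 𝒜.fiber t, x = a * star b} := by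
    refine one_mem_of_topologicalClosure_eq (𝒜.fiber_closed 1) h1
      (fun hx hy => 𝒜.mul_mem' hx hy (one_mul 1)) (h t) fun {x y} hx hy => ?_
    induction hy using Submodule.span_induction with
    | mem y hy =>
      obtain ⟨a, ha, b, hb, rfl⟩ := hy
      rw [← mul_assoc]
      exact Submodule.subset_span ⟨_, 𝒜.mul_mem' hx ha (one_mul t), b, hb, rfl⟩
    | zero => simp
    | add y y' _ _ hy hy' => rw [mul_add]; exact add_mem hy hy'
    | smul z y _ hy => rw [mul_smul_comm]; exact Submodule.smul_mem _ _ hy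
  obtain ⟨f, s, hs, -, hsum⟩ := Submodule.mem_span_iff_exists_finset_subset.1 hone
  choose! a ha b hb hab using fun x (hx : x ∈ (s : Set C)) => hs hx
  let e := s.equivFin
  refine ⟨s.card, fun i => f (e.symm i) • a (e.symm i), fun i => b (e.symm i),
    fun i => Submodule.smul_mem _ _ (ha _ (e.symm i).2), fun i => hb _ (e.symm i).2, ?_⟩
  rw [Equiv.sum_comp e.symm fun x : s => f x • a x * star (b x), ← hsum,
    Finset.sum_coe_sort s fun x => f x • a x * star (b x)]
  exact Finset.sum_congr rfl fun x hx => by rw [smul_mul_assoc, ← hab x hx]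

end Bundle

namespace HilbertBimod

variable {C D Y : Type*} [CStarAlgebra C] [CStarAlgebra D] [NormedAddCommGroup Y]
  {E : HilbertBimod C D Y} {G : Type*} [Group G] [DecidableEq G]

theorem IsEquivSubBimod.flip {𝒜 : CStarBundle G C} {ℬ : CStarBundle G D} {X : AddSubgroup Y}
    (hX : E.IsEquivSubBimod (𝒜.fiber 1) (ℬ.fiber 1) X) :
    E.flip.IsEquivSubBimod (ℬ.fiber 1) (𝒜.fiber 1) X where
  lsmul_mem hb hx := hX.rsmul_mem hx (ℬ.star_mem' hb)
  rsmul_mem hx ha := hX.lsmul_mem (𝒜.star_mem' ha) hx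
  rinner_mem := hX.linner_mem
  lUnital := hX.rUnital
  linner_mem := hX.rinner_mem
  rUnital := hX.lUnital

section LeftFiber

variable {𝒜 : CStarBundle G C} {B : Submodule ℂ D} {X : AddSubgroup Y}

theorem lsmul_mem_leftFiber {t s : G} {c : C} {y : Y} (hc : c ∈ 𝒜.fiber t)
    (hy : y ∈ E.leftFiber X (𝒜.fiber s)) : E.lsmul c y ∈ E.leftFiber X (𝒜.fiber (t * s)) := by
  intro x hx
  rw [E.linner_lsmul_left]
  exact 𝒜.mul_mem hc (hy x hx)

namespace IsEquivSubBimod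

variable (hX : E.IsEquivSubBimod (𝒜.fiber 1) B X)
include hX

theorem lsmul_mem_leftFiber {t : G} {c : C} {x : Y} (hc : c ∈ 𝒜.fiber t) (hx : x ∈ X) :
    E.lsmul c x ∈ E.leftFiber X (𝒜.fiber t) := by
  intro y hy
  rw [E.linner_lsmul_left]
  exact 𝒜.mul_mem' hc (hX.linner_mem hx hy) (mul_one t)

theorem rsmul_mem_leftFiber (hB : ∀ b ∈ B, star b ∈ B) {t : G} {b : D} {y : Y} (hb : b ∈ B)
    (hy : y ∈ E.leftFiber X (𝒜.fiber t)) : E.rsmul y b ∈ E.leftFiber X (𝒜.fiber t) := by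
  intro x hx
  rw [hX.lUnital.linner_rsmul_left]
  exact hy _ (hX.rsmul_mem hx (hB b hb))

theorem exists_frame : ∃ (n : ℕ) (u v : Fin n → Y), (∀ i, u i ∈ X) ∧ (∀ i, v i ∈ X) ∧
    ∀ y, ∑ i, E.lsmul (E.linner y (u i)) (v i) = y := by
  obtain ⟨n, u, v, hu, hv, h⟩ := hX.rUnital
  refine ⟨n, u, v, hu, hv, fun y => ?_⟩
  conv_rhs => rw [← E.rsmul_one y, ← h, rsmul_sum]
  exact Finset.sum_congr rfl fun i _ => E.inner_assoc _ _ _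

theorem linner_mem_of_leftFiber {t s : G} {x y : Y} (hx : x ∈ E.leftFiber X (𝒜.fiber t))
    (hy : y ∈ E.leftFiber X (𝒜.fiber s)) : E.linner x y ∈ 𝒜.fiber (t * s⁻¹) := by
  obtain ⟨n, u, v, hu, hv, h⟩ := hX.exists_frame
  rw [← h x, sum_linner]
  refine Submodule.sum_mem _ fun i _ => ?_
  rw [E.linner_lsmul_left, ← E.linner_star y]
  exact 𝒜.mul_mem (hx _ (hu i)) (𝒜.star_mem (hy _ (hv i)))

theorem rinner_lsmul_left (c : C) (x y : Y) :
    E.rinner (E.lsmul c x) y = E.rinner x (E.lsmul (star c) y) := by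
  simpa [HilbertBimod.flip] using hX.rUnital.linner_rsmul_left x y (star c)

theorem rinner_mem_of_leftFiber {t : G} {x y : Y} (hx : x ∈ E.leftFiber X (𝒜.fiber t))
    (hy : y ∈ E.leftFiber X (𝒜.fiber t)) : E.rinner x y ∈ B := by
  obtain ⟨n, u, v, hu, hv, h⟩ := hX.exists_frame
  have hxy : E.flip.linner x y ∈ B := by
    rw [← h x, ← h y, sum_linner]
    refine Submodule.sum_mem _ fun i _ => ?_
    rw [linner_sum]
    refine Submodule.sum_mem _ fun j _ => ?_
    change E.rinner _ _ ∈ B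
    rw [hX.rinner_lsmul_left, ← E.mul_lsmul]
    exact hX.rinner_mem (hv i) (hX.lsmul_mem
      (𝒜.mul_mem' (𝒜.star_mem (hx _ (hu i))) (hy _ (hu j)) (inv_mul_cancel t)) (hv j))
  exact hxy

theorem lUnital_leftFiber (hsat : 𝒜.Saturated) (h1 : (1 : C) ∈ 𝒜.fiber 1) (t : G) :
    E.LUnital (E.leftFiber X (𝒜.fiber t)) := by
  obtain ⟨n, a, b, ha, hb, hab⟩ := hsat.exists_sum_eq_one h1 t
  obtain ⟨m, x, y, hx, hy, hxy⟩ := hX.lUnital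
  refine E.lUnital_of_fintype (ι := Fin n × Fin m) (x := fun p => E.lsmul (a p.1) (x p.2))
    (y := fun p => E.lsmul (b p.1) (y p.2)) (fun p => hX.lsmul_mem_leftFiber (ha _) (hx _))
    (fun p => hX.lsmul_mem_leftFiber (hb _) (hy _)) ?_
  rw [Fintype.sum_prod_type, ← hab]
  refine Finset.sum_congr rfl fun i _ => ?_
  simp only [E.linner_lsmul_left, linner_lsmul_right, ← Finset.mul_sum, ← Finset.sum_mul, hxy,
    one_mul]

theorem rUnital_leftFiber (hsat : 𝒜.Saturated) (h1 : (1 : C) ∈ 𝒜.fiber 1) (t : G) :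
    E.flip.LUnital (E.leftFiber X (𝒜.fiber t)) := by
  obtain ⟨n, a, b, ha, hb, hab⟩ := hsat.exists_sum_eq_one h1 t⁻¹
  obtain ⟨m, x, y, hx, hy, hxy⟩ := hX.rUnital
  have hstar : ∀ {c : C}, c ∈ 𝒜.fiber t⁻¹ → star c ∈ 𝒜.fiber t := fun hc => by
    simpa using 𝒜.star_mem hc
  refine lUnital_of_fintype E.flip (ι := Fin m × Fin n)
    (x := fun p => E.lsmul (star (a p.2)) (x p.1)) (y := fun p => E.lsmul (star (b p.2)) (y p.1))
    (fun p => hX.lsmul_mem_leftFiber (hstar (ha _)) (hx _))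
    (fun p => hX.lsmul_mem_leftFiber (hstar (hb _)) (hy _)) ?_
  rw [Fintype.sum_prod_type, ← hxy]
  refine Finset.sum_congr rfl fun i _ => ?_
  conv_rhs => rw [← E.one_lsmul (y i), ← hab, sum_lsmul, linner_sum]
  refine Finset.sum_congr rfl fun j _ => ?_
  change E.rinner _ _ = E.rinner _ _
  rw [hX.rinner_lsmul_left, star_star, E.mul_lsmul]

theorem isInternal_leftFiber [Fintype G] :
    DirectSum.IsInternal fun t => E.leftFiber X (𝒜.fiber t) := by
  obtain ⟨n, u, v, hu, hv, h⟩ := hX.exists_frame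
  obtain ⟨hex, huniq⟩ := (isInternal_iff_sum 𝒜.fiber).1 𝒜.isInternal
  refine (isInternal_iff_sum _).2 ⟨fun y => ?_, fun z hz h0 t => ?_⟩
  · choose a ha hsum using fun i => hex (E.linner y (u i))
    refine ⟨fun t => ∑ i, E.lsmul (a i t) (v i), fun t => AddSubgroup.sum_mem _ fun i _ =>
      hX.lsmul_mem_leftFiber (ha i t) (hv i), ?_⟩
    rw [Finset.sum_comm]
    conv_rhs => rw [← h y]
    exact Finset.sum_congr rfl fun i _ => by rw [← sum_lsmul, hsum]
  · rw [← h (z t)]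
    refine Finset.sum_eq_zero fun i _ => ?_
    rw [huniq (fun t => E.linner (z t) (u i)) (fun t => hz t _ (hu i))
      (by rw [← sum_linner, h0, zero_linner]) t, zero_lsmul]

end IsEquivSubBimod

end LeftFiber

theorem rsmul_mem_flip_leftFiber {ℬ : CStarBundle G D} {X : AddSubgroup Y}
    {t s : G} {d : D} {y : Y} (hd : d ∈ ℬ.fiber t)
    (hy : y ∈ E.flip.leftFiber X (ℬ.fiber s)) :
    E.rsmul y d ∈ E.flip.leftFiber X (ℬ.fiber (t⁻¹ * s)) := by
  rw [rsmul_eq_flip]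
  exact lsmul_mem_leftFiber (ℬ.star_mem hd) hy

namespace IsEquivSubBimod

variable {𝒜 : CStarBundle G C} {ℬ : CStarBundle G D} {X : AddSubgroup Y}
  (hX : E.IsEquivSubBimod (𝒜.fiber 1) (ℬ.fiber 1) X)

include hX in
theorem isUnitalSubBimod_leftFiber (hsat : 𝒜.Saturated) (h1 : (1 : C) ∈ 𝒜.fiber 1) (t : G) :
    E.IsUnitalSubBimod (𝒜.fiber 1) (ℬ.fiber 1) (E.leftFiber X (𝒜.fiber t)) where
  lsmul_mem ha hx := by simpa using HilbertBimod.lsmul_mem_leftFiber ha hx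
  rsmul_mem hx hb := hX.rsmul_mem_leftFiber (fun _ => ℬ.star_mem') hb hx
  rinner_mem := hX.rinner_mem_of_leftFiber
  lUnital := hX.lUnital_leftFiber hsat h1 t

include hX in
theorem isUnitalSubBimod_flip_leftFiber (hsat : ℬ.Saturated) (h1 : (1 : D) ∈ ℬ.fiber 1) (s : G) :
    E.IsUnitalSubBimod (𝒜.fiber 1) (ℬ.fiber 1) (E.flip.leftFiber X (ℬ.fiber s)) where
  lsmul_mem {a x} ha hx := by
    simpa [flip_lsmul, HilbertBimod.flip] using
      hX.flip.rsmul_mem_leftFiber (fun _ => 𝒜.star_mem') (𝒜.star_mem' ha) hx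
  rsmul_mem hx hb := by simpa using HilbertBimod.rsmul_mem_flip_leftFiber hb hx
  rinner_mem hx hy := by simpa [flip_linner] using hX.flip.linner_mem_of_leftFiber hx hy
  lUnital := hX.flip.rUnital_leftFiber hsat h1 s

include hX in
theorem exists_leftFiber_eq [Nontrivial C] [Fintype G] (hsatA : 𝒜.Saturated)
    (hsatB : ℬ.Saturated) (h1A : (1 : C) ∈ 𝒜.fiber 1) (h1B : (1 : D) ∈ ℬ.fiber 1)
    (hcomm : ∀ x : C, (∀ a ∈ 𝒜.fiber 1, a * x = x * a) → ∃ z : ℂ, x = z • (1 : C)) (t : G) :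
    ∃ s, E.leftFiber X (𝒜.fiber t) = E.flip.leftFiber X (ℬ.fiber s) := by
  have hL := hX.isUnitalSubBimod_leftFiber hsatA h1A
  have hR := hX.isUnitalSubBimod_flip_leftFiber hsatB h1B
  obtain ⟨s, hs⟩ := (hL t).exists_le h1A hcomm hX.flip.isInternal_leftFiber
    (fun s _ ha _ hy => (hR s).lsmul_mem ha hy) (fun s _ hb _ hy => (hR s).rsmul_mem hy hb)
  obtain ⟨t', ht'⟩ := (hR s).exists_le h1A hcomm hX.isInternal_leftFiber
    (fun s _ ha _ hy => (hL s).lsmul_mem ha hy) (fun s _ hb _ hy => (hL s).rsmul_mem hy hb)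
  obtain ⟨y, hy, hy0⟩ := (hL t).lUnital.exists_ne_zero
  have : t = t' := hX.isInternal_leftFiber.index_eq_of_mem hy (ht' (hs hy)) hy0
  exact ⟨s, le_antisymm hs (this ▸ ht')⟩

include hX in
/-- The two gradings of `Y` induced by the bundles agree up to an automorphism of the group. -/
theorem exists_mulEquiv [Nontrivial C] [Fintype G] (hsatA : 𝒜.Saturated)
    (hsatB : ℬ.Saturated) (h1A : (1 : C) ∈ 𝒜.fiber 1) (h1B : (1 : D) ∈ ℬ.fiber 1)
    (hcomm : ∀ x : C, (∀ a ∈ 𝒜.fiber 1, a * x = x * a) → ∃ z : ℂ, x = z • (1 : C)) :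
    ∃ f : G ≃* G, ∀ t,
      E.leftFiber X (𝒜.fiber t) = E.flip.leftFiber X (ℬ.fiber (f t)⁻¹) := by
  choose g hg using hX.exists_leftFiber_eq hsatA hsatB h1A h1B hcomm
  have hL := hX.lUnital_leftFiber hsatA h1A
  have hmul : ∀ t s, g (t * s) = g s * g t := by
    intro t s
    obtain ⟨a, ha, z, hz, haz⟩ : ∃ a ∈ 𝒜.fiber t, ∃ z ∈ E.leftFiber X (𝒜.fiber s),
        E.lsmul a z ≠ 0 := by
      by_contra! h
      obtain ⟨z, hz, hz0⟩ := (hL s).exists_ne_zero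
      obtain ⟨n, a, b, ha, hb, hab⟩ := hsatA.exists_sum_eq_one h1A t⁻¹
      apply hz0
      rw [← E.one_lsmul z, ← hab, sum_lsmul]
      refine Finset.sum_eq_zero fun i _ => ?_
      rw [E.mul_lsmul, h _ (by simpa using 𝒜.star_mem (hb i)) z hz, lsmul_zero]
    refine hX.flip.isInternal_leftFiber.index_eq_of_mem (y := E.lsmul a z) ?_ ?_ haz
    · rw [← hg]
      exact HilbertBimod.lsmul_mem_leftFiber ha hz
    · rw [hg] at hz
      obtain ⟨n, u, v, hu, hv, h⟩ := hX.flip.exists_frame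
      rw [← h z, lsmul_sum]
      refine AddSubgroup.sum_mem _ fun i _ => ?_
      have hav : E.lsmul a (v i) ∈ E.flip.leftFiber X (ℬ.fiber (g t)) :=
        hg t ▸ hX.lsmul_mem_leftFiber ha (hv i)
      rw [flip_lsmul, ← E.lsmul_rsmul, rsmul_eq_flip, star_star]
      exact HilbertBimod.lsmul_mem_leftFiber (hz _ (hu i)) hav
  have hinj : Function.Injective g := by
    intro t t' h
    obtain ⟨y, hy, hy0⟩ := (hL t).exists_ne_zero
    refine hX.isInternal_leftFiber.index_eq_of_mem hy ?_ hy0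
    rwa [hg t', ← h, ← hg t]
  refine ⟨MulEquiv.ofBijective (MonoidHom.mk' (fun t => (g t)⁻¹) fun t s => ?_)
    (Finite.injective_iff_bijective.1 (inv_injective.comp hinj)), fun t => ?_⟩
  · rw [hmul, mul_inv_rev]
  · simpa using hg t

variable {f : G ≃* G}
  (hf : ∀ t, E.leftFiber X (𝒜.fiber t) = E.flip.leftFiber X (ℬ.fiber (f t)⁻¹))

/-- The equivalence bundle formed by the components `A_t X = X B_{f t}`. -/
def equivBundleData [Fintype G] : EquivBundleData 𝒜.fiber (fun t => ℬ.fiber (f t)) E where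
  fiber t := E.leftFiber X (𝒜.fiber t)
  fiber_closed t := isClosed_leftFiber X (𝒜.fiber_closed t)
  isInternal := hX.isInternal_leftFiber
  lsmul_mem := HilbertBimod.lsmul_mem_leftFiber
  rsmul_mem {t s x d} hx hd := by
    rw [hf] at hx ⊢
    simpa using HilbertBimod.rsmul_mem_flip_leftFiber hd hx
  linner_mem := hX.linner_mem_of_leftFiber
  rinner_mem {t s x y} hx hy := by
    rw [hf] at hx hy
    simpa [flip_linner] using hX.flip.linner_mem_of_leftFiber hx hy

theorem equivBundleData_strictSpan [Fintype G] (hsatA : 𝒜.Saturated)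
    (h1A : (1 : C) ∈ 𝒜.fiber 1) :
    (hX.equivBundleData hf).StrictSpan := by
  refine ⟨fun t s => le_antisymm (Submodule.span_le.2 ?_) fun c hc => ?_,
    fun t s => le_antisymm (Submodule.span_le.2 ?_) fun d hd => ?_⟩
  · rintro _ ⟨x, hx, y, hy, rfl⟩
    exact (hX.equivBundleData hf).linner_mem hx hy
  · obtain ⟨n, x, y, hx, hy, h⟩ := hX.lUnital_leftFiber hsatA h1A s
    rw [← mul_one c, ← h, Finset.mul_sum]
    refine Submodule.sum_mem _ fun i _ => Submodule.subset_span
      ⟨E.lsmul c (x i), ?_, y i, hy i, (E.linner_lsmul_left _ _ _).symm⟩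
    simpa using (hX.equivBundleData hf).lsmul_mem hc (hx i)
  · rintro _ ⟨x, hx, y, hy, rfl⟩
    exact (hX.equivBundleData hf).rinner_mem hx hy
  · obtain ⟨n, x, y, hx, hy, h⟩ := hX.rUnital_leftFiber hsatA h1A t
    rw [← one_mul d, ← h, Finset.sum_mul]
    refine Submodule.sum_mem _ fun i _ => Submodule.subset_span
      ⟨x i, hx i, E.rsmul (y i) d, ?_, (E.rinner_rsmul_right _ _ _).symm⟩
    simpa using (hX.equivBundleData hf).rsmul_mem (hy i) hd

end IsEquivSubBimod

/-- A dense span of left inner products over `X` in a closed unital subalgebra acting on `X`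
attains the unit. -/
theorem lUnital_of_topologicalClosure_eq {A : Submodule ℂ C} {X : AddSubgroup Y}
    (hA : IsClosed (A : Set C)) (h1 : (1 : C) ∈ A)
    (hmul : ∀ {x y : C}, x ∈ A → y ∈ A → x * y ∈ A)
    (hX : ∀ {a : C} {x : Y}, a ∈ A → x ∈ X → E.lsmul a x ∈ X)
    (hfull : (Submodule.span ℂ
      {c : C | ∃ x ∈ X, ∃ y ∈ X, c = E.linner x y}).topologicalClosure = A) :
    E.LUnital X := by
  refine LUnital.of_one_mem_span (fun z x hx => hX (A.smul_mem z h1) hx)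
    (one_mem_of_topologicalClosure_eq hA h1 hmul hfull fun {a c} ha hc => ?_)
  induction hc using Submodule.span_induction with
  | mem c hc =>
    obtain ⟨x, hx, y, hy, rfl⟩ := hc
    exact Submodule.subset_span ⟨_, hX ha hx, y, hy, (E.linner_lsmul_left _ _ _).symm⟩
  | zero => simp
  | add c c' _ _ hc hc' => rw [mul_add]; exact add_mem hc hc'
  | smul z c _ hc => rw [mul_smul_comm]; exact Submodule.smul_mem _ _ hc

end HilbertBimod

/-- Theorem 4.6 of the paper.
Let `𝒜 = {A_t}_{t∈G}` and `ℬ = {B_t}_{t∈G}` be saturated C*-algebraic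
bundles over a finite group `G` with unital section algebras `C = ⊕_t A_t`
and `D = ⊕_t B_t`, `1_C ∈ A_e`, `1_D ∈ B_e`, and suppose `A' ∩ C = ℂ1`.
If the induced unital inclusions `A ⊆ C` and `B ⊆ D` are strongly Morita
equivalent, then there exist an automorphism `f` of `G` and an
`𝒜`-`ℬ^f`-equivalence bundle `{Z_t}_{t∈G}` with
`⟨Z_t , Z_s⟩_C = A_{ts⁻¹}` and `⟨Z_t , Z_s⟩_D = B_{f(t⁻¹s)}` for all
`t, s ∈ G`, where `ℬ^f = {B_{f(t)}}_{t∈G}`. -/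
theorem strong_morita_of_inclusions_implies_equivalence_bundle
    {G : Type} [Group G] [Fintype G] [DecidableEq G]
    {C D : Type} [CStarAlgebra C] [CStarAlgebra D]
    (𝒜 : CStarBundle G C) (ℬ : CStarBundle G D)
    (hsatA : 𝒜.Saturated) (hsatB : ℬ.Saturated)
    (h1A : (1 : C) ∈ 𝒜.fiber 1) (h1B : (1 : D) ∈ ℬ.fiber 1)
    -- `A' ∩ C = ℂ1`:
    (hcomm : ∀ x : C, (∀ a ∈ 𝒜.fiber 1, a * x = x * a) → ∃ z : ℂ, x = z • (1 : C))
    (hSME : StronglyMoritaEquivalentIncl C D (𝒜.fiber 1) (ℬ.fiber 1)) :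
    ∃ f : G ≃* G,
      ∃ Zc : EquivBundleCarrier 𝒜.fiber (fun t => ℬ.fiber (f t)),
        Zc.bundle.StrictSpan := by
  obtain ⟨M⟩ := hSME
  let := M.instN
  have := M.instC
  have hX : M.E.IsEquivSubBimod (𝒜.fiber 1) (ℬ.fiber 1) M.X₀ :=
    { lsmul_mem := M.lsmul_mem
      rsmul_mem := M.rsmul_mem
      linner_mem := M.linner_mem
      rinner_mem := M.rinner_mem
      lUnital := HilbertBimod.lUnital_of_topologicalClosure_eq (𝒜.fiber_closed 1) h1A
        (fun hx hy => 𝒜.mul_mem' hx hy (one_mul 1)) M.lsmul_mem M.linner_full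
      rUnital := HilbertBimod.lUnital_of_topologicalClosure_eq (ℬ.fiber_closed 1) h1B
        (fun hx hy => ℬ.mul_mem' hx hy (one_mul 1))
        (fun hb hx => M.rsmul_mem hx (ℬ.star_mem' hb)) M.rinner_full }
  obtain ⟨f, hf⟩ : ∃ f : G ≃* G, ∀ t, M.E.leftFiber M.X₀ (𝒜.fiber t) =
      M.E.flip.leftFiber M.X₀ (ℬ.fiber (f t)⁻¹) := by
    rcases subsingleton_or_nontrivial C with h | h
    · have hY : ∀ y : M.Y, y = 0 := fun y => by
        rw [← M.E.one_lsmul y, Subsingleton.elim (1 : C) 0, HilbertBimod.zero_lsmul]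
      refine ⟨MulEquiv.refl G, fun t => AddSubgroup.ext fun y => ?_⟩
      simp [hY y]
    · exact hX.exists_mulEquiv hsatA hsatB h1A h1B hcomm
  exact ⟨f, ⟨M.Y, M.E, M.lFull, M.rFull, hX.equivBundleData hf⟩,
    hX.equivBundleData_strictSpan hf hsatA h1A⟩
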